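/- arXiv:2508.03354 — 3 statements merged into one kernel-verified Lean document; each statement's English description precedes it below -/
import Mathlib

section
/- Let T > 0, σ > 0 and λ₁₁, λ₁₂, λ₂₁, λ₂₂ > 0 be real constants, let m₁, m₂ : [0, T] → (0, ∞) be continuous, and let h₁, h₂ : [0, T] → (0, ∞) be differentiable functions satisfying the coupled system h₁′(t) = −σ h₁(t) − λ₁₁ m₁(t) h₁(t)^{−2} − λ₁₂ m₂(t) h₂(t)^{−2} and h₂′(t) = −σ h₂(t) − λ₂₁ m₂(t) h₂(t)^{−2} − λ₂₂ m₁(t) h₁(t)^{−2}. Set λ̃ = min{λ₁₁ + λ₂₂, λ₁₂ + λ₂₁} and E(t) = h₁(t) + h₂(t). Then for every t ∈ [0, T], E′(t) ≤ −σ E(t) − 4 λ̃ · min{m₁(t), m₂(t)} · E(t)^{−2}. -/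
open MeasureTheory Set Real

/-- Elementary convexity-type inequality for inverse squares of positive reals. -/
theorem four_mul_zpow_neg_two_add_le {a b : ℝ} (ha : 0 < a) (hb : 0 < b) :
    4 * (a + b) ^ (-2 : ℤ) ≤ a ^ (-2 : ℤ) + b ^ (-2 : ℤ) := by
  have key : ∀ x : ℝ, x ^ (-2 : ℤ) = 1 / x ^ 2 := fun x => by
    rw [zpow_neg, one_div]; norm_cast
  rw [key, key, key, div_add_div _ _ (by positivity) (by positivity), mul_one_div,
    div_le_div_iff₀ (by positivity) (by positivity)]
  have h : 0 ≤ a * b * (a ^ 2 + b ^ 2) := by positivity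
  nlinarith [sq_nonneg (a ^ 2 - b ^ 2)]

/-- If `h₁, h₂ : [0,T] → (0,∞)` solve the coupled ODE system
`h₁' = -σ h₁ - λ₁₁ m₁ h₁⁻² - λ₁₂ m₂ h₂⁻²`,
`h₂' = -σ h₂ - λ₂₁ m₂ h₂⁻² - λ₂₂ m₁ h₁⁻²`,
with `m₁, m₂ : [0,T] → (0,∞)` continuous, then `E = h₁ + h₂` satisfies
`E' ≤ -σ E - 4 λ̃ min{m₁, m₂} E⁻²` on `[0,T]`, where
`λ̃ = min{λ₁₁ + λ₂₂, λ₁₂ + λ₂₁}`. -/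
theorem coupled_system_energy_inequality
    (T σ l₁₁ l₁₂ l₂₁ l₂₂ : ℝ)
    (hT : 0 < T) (hσ : 0 < σ)
    (hl₁₁ : 0 < l₁₁) (hl₁₂ : 0 < l₁₂) (hl₂₁ : 0 < l₂₁) (hl₂₂ : 0 < l₂₂)
    (m₁ m₂ h₁ h₂ : ℝ → ℝ)
    (hm₁_cont : ContinuousOn m₁ (Set.Icc 0 T))
    (hm₂_cont : ContinuousOn m₂ (Set.Icc 0 T))
    (hm₁_pos : ∀ t ∈ Set.Icc (0:ℝ) T, 0 < m₁ t)
    (hm₂_pos : ∀ t ∈ Set.Icc (0:ℝ) T, 0 < m₂ t)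
    (hh₁_pos : ∀ t ∈ Set.Icc (0:ℝ) T, 0 < h₁ t)
    (hh₂_pos : ∀ t ∈ Set.Icc (0:ℝ) T, 0 < h₂ t)
    (hh₁ : ∀ t ∈ Set.Icc (0:ℝ) T,
      HasDerivAt h₁
        (-σ * h₁ t - l₁₁ * m₁ t * (h₁ t) ^ (-2 : ℤ) - l₁₂ * m₂ t * (h₂ t) ^ (-2 : ℤ)) t)
    (hh₂ : ∀ t ∈ Set.Icc (0:ℝ) T,
      HasDerivAt h₂
        (-σ * h₂ t - l₂₁ * m₂ t * (h₂ t) ^ (-2 : ℤ) - l₂₂ * m₁ t * (h₁ t) ^ (-2 : ℤ)) t) :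
    ∀ t ∈ Set.Icc (0:ℝ) T,
      deriv (fun s => h₁ s + h₂ s) t ≤
        -σ * (h₁ t + h₂ t) -
          4 * min (l₁₁ + l₂₂) (l₁₂ + l₂₁) * min (m₁ t) (m₂ t) * (h₁ t + h₂ t) ^ (-2 : ℤ) := by
  intro t ht
  have hm₁ := hm₁_pos t ht
  have hm₂ := hm₂_pos t ht
  have hx : 0 < h₁ t ^ (-2 : ℤ) := zpow_pos (hh₁_pos t ht) _
  have hy : 0 < h₂ t ^ (-2 : ℤ) := zpow_pos (hh₂_pos t ht) _
  have hconv := four_mul_zpow_neg_two_add_le (hh₁_pos t ht) (hh₂_pos t ht)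
  have hderiv : deriv (fun s => h₁ s + h₂ s) t = _ := ((hh₁ t ht).add (hh₂ t ht)).deriv
  rw [hderiv]
  set l := min (l₁₁ + l₂₂) (l₁₂ + l₂₁)
  set m := min (m₁ t) (m₂ t)
  have hl : 0 < l := lt_min (by positivity) (by positivity)
  have hm : 0 < m := lt_min hm₁ hm₂
  have hfirst : l * m * h₁ t ^ (-2 : ℤ) ≤ (l₁₁ + l₂₂) * m₁ t * h₁ t ^ (-2 : ℤ) := by
    gcongr
    exacts [min_le_left _ _, min_le_left _ _]
  have hsecond : l * m * h₂ t ^ (-2 : ℤ) ≤ (l₁₂ + l₂₁) * m₂ t * h₂ t ^ (-2 : ℤ) := by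
    gcongr
    exacts [min_le_right _ _, min_le_right _ _]
  have hsum := mul_le_mul_of_nonneg_left hconv (mul_pos hl hm).le
  linarith
end

section
/- Let T > 0, σ > 0 and c > 0 be real constants and let m : [0, T] → [0, ∞) be continuous. If there exists a differentiable function E : [0, T] → (0, ∞) satisfying E′(t) ≤ −σ E(t) − c · m(t) · E(t)^{−2} for all t ∈ [0, T], then necessarily 3c ∫₀^T m(s) e^{3σ s} ds < E(0)³. Consequently, if 3c ∫₀^T m(s) e^{3σ s} ds ≥ E(0)³, no strictly positive differentiable solution of this differential inequality exists on [0, T]. -/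
open MeasureTheory Set Real

/-- If there exists a strictly positive differentiable `E : [0,T] → (0,∞)`
satisfying `E' ≤ -σ E - c m E⁻²` on `[0,T]`, then necessarily
`3c ∫₀ᵀ m(s) e^{3σ s} ds < E(0)³`.  (Consequently, if
`3c ∫₀ᵀ m(s) e^{3σ s} ds ≥ E(0)³`, no strictly positive differentiable solution of
the differential inequality exists on `[0,T]` — the contrapositive of this claim.) -/
theorem quenching_mechanism_necessary_condition
    (T σ c : ℝ) (hT : 0 < T) (hσ : 0 < σ) (hc : 0 < c)
    (m : ℝ → ℝ)
    (hm_cont : ContinuousOn m (Set.Icc 0 T))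
    (hm_nonneg : ∀ t ∈ Set.Icc (0:ℝ) T, 0 ≤ m t)
    (E E' : ℝ → ℝ)
    (hE_pos : ∀ t ∈ Set.Icc (0:ℝ) T, 0 < E t)
    (hE_deriv : ∀ t ∈ Set.Icc (0:ℝ) T, HasDerivAt E (E' t) t)
    (hE_ineq : ∀ t ∈ Set.Icc (0:ℝ) T,
      E' t ≤ -σ * E t - c * m t * (E t) ^ (-2 : ℤ)) :
    3 * c * (∫ s in (0:ℝ)..T, m s * Real.exp (3 * σ * s)) < (E 0) ^ 3 := by
  have hderiv : ∀ t ∈ Icc (0:ℝ) T, HasDerivAt (fun t => exp (3 * σ * t) * E t ^ 3)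
      (3 * exp (3 * σ * t) * E t ^ 2 * (E' t + σ * E t)) t := by
    intro t ht
    have hexp : HasDerivAt (fun t => exp (3 * σ * t)) (exp (3 * σ * t) * (3 * σ)) t := by
      simpa using ((hasDerivAt_id t).const_mul (3 * σ)).exp
    refine (hexp.mul ((hE_deriv t ht).pow 3)).congr_deriv ?_
    simp only [Pi.pow_apply]
    push_cast
    ring
  have hbound : ∀ t ∈ Icc (0:ℝ) T, 3 * exp (3 * σ * t) * E t ^ 2 * (E' t + σ * E t) ≤
      -(3 * c) * (m t * exp (3 * σ * t)) := by
    intro t ht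
    have hpos := hE_pos t ht
    calc 3 * exp (3 * σ * t) * E t ^ 2 * (E' t + σ * E t)
        ≤ 3 * exp (3 * σ * t) * E t ^ 2 * (-(c * m t * E t ^ (-2 : ℤ))) := by
          gcongr
          linarith [hE_ineq t ht]
      _ = -(3 * c) * (m t * exp (3 * σ * t)) := by
          rw [zpow_neg, zpow_ofNat]
          field_simp
  have hcont : ContinuousOn (fun t => -(3 * c) * (m t * exp (3 * σ * t))) (Icc 0 T) := by
    fun_prop
  have hle := intervalIntegral.sub_le_integral_of_hasDeriv_right_of_le hT.le
    (fun t ht => (hderiv t ht).continuousAt.continuousWithinAt)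
    (fun t ht => (hderiv t (Ioo_subset_Icc_self ht)).hasDerivWithinAt)
    hcont.integrableOn_Icc
    (fun t ht => hbound t (Ioo_subset_Icc_self ht))
  rw [intervalIntegral.integral_const_mul] at hle
  simp only [mul_zero, exp_zero, one_mul] at hle
  have hfinal : 0 < exp (3 * σ * T) * E T ^ 3 :=
    mul_pos (exp_pos _) (pow_pos (hE_pos T (right_mem_Icc.mpr hT.le)) 3)
  linarith
end

section
/- Let H and α be real numbers with 1/2 < H < α < 1, let U > 0 and let ρ₁, ρ₂ ∈ ℝ. Then sup_{t ≥ 0} (2ρ₁² t + 2ρ₂² t^{2H}) / (ln(U + 1) + t^α)² ≤ (ρ₁² (2α − 1)^{2 − 1/α} / α²) · (ln(U + 1))^{1/α − 2} + 2ρ₂² · (ln(U + 1))^{2H/α − 2} · ((α − H)/α)^{2 − 2H/α}. -/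
open Real

/-- The map `x ↦ x ^ (2 * p) / (A + x) ^ 2` on `[0, ∞)` is bounded by its value at
`x = p * A / (1 - p)`. -/
theorem rpow_two_mul_div_add_sq_le {A x p : ℝ} (hA : 0 < A) (hx : 0 ≤ x) (hp : 0 < p)
    (hp1 : p < 1) :
    x ^ (2 * p) / (A + x) ^ 2 ≤ p ^ (2 * p) * (1 - p) ^ (2 - 2 * p) * A ^ (2 * p - 2) := by
  have hq : 0 < 1 - p := sub_pos.2 hp1
  have hsq {y : ℝ} (hy : 0 ≤ y) (r : ℝ) : y ^ (2 * r) = (y ^ r) ^ 2 := by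
    rw [mul_comm, rpow_mul hy, rpow_two]
  have key : (A / (1 - p)) ^ (1 - p) * (x / p) ^ p ≤ A + x := by
    refine (geom_mean_le_arith_mean2_weighted hq.le hp.le (by positivity) (by positivity)
      (by ring)).trans_eq ?_
    field_simp
  rw [div_rpow hA.le hq.le, div_rpow hx hp.le, div_mul_div_comm,
    div_le_iff₀ (by positivity)] at key
  rw [show 2 - 2 * p = 2 * (1 - p) by ring, show 2 * p - 2 = -(2 * (1 - p)) by ring,
    rpow_neg hA.le, hsq hx, hsq hp.le, hsq hq.le, hsq hA.le, ← div_eq_mul_inv,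
    div_le_div_iff₀ (by positivity) (by positivity)]
  calc (x ^ p) ^ 2 * (A ^ (1 - p)) ^ 2 = (A ^ (1 - p) * x ^ p) ^ 2 := by ring
    _ ≤ ((A + x) * ((1 - p) ^ (1 - p) * p ^ p)) ^ 2 := by gcongr
    _ = _ := by ring

/-- For `1/2 < H < α < 1`, `U > 0` and `ρ₁, ρ₂ ∈ ℝ`,
`sup_{t ≥ 0} (2ρ₁² t + 2ρ₂² t^{2H}) / (ln(U+1) + t^α)²
  ≤ (ρ₁² (2α-1)^{2-1/α}/α²) (ln(U+1))^{1/α-2}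
    + 2ρ₂² (ln(U+1))^{2H/α-2} ((α-H)/α)^{2-2H/α}`. -/
theorem malliavin_constant_LU_bound
    (H α U ρ₁ ρ₂ : ℝ) (hH : 1/2 < H) (hHα : H < α) (hα : α < 1) (hU : 0 < U) :
    ∀ t : ℝ, 0 ≤ t →
      (2 * ρ₁ ^ 2 * t + 2 * ρ₂ ^ 2 * t ^ (2 * H)) / (Real.log (U + 1) + t ^ α) ^ 2 ≤
        (ρ₁ ^ 2 * (2 * α - 1) ^ (2 - 1/α) / α ^ 2) * (Real.log (U + 1)) ^ (1/α - 2) +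
          2 * ρ₂ ^ 2 * (Real.log (U + 1)) ^ (2 * H / α - 2) *
            ((α - H) / α) ^ (2 - 2 * H / α) := by
  intro t ht
  have hA : 0 < Real.log (U + 1) := Real.log_pos (by linarith)
  set A := Real.log (U + 1)
  have hα0 : 0 < α := by linarith
  have hα1 : 0 < 2 * α - 1 := by linarith
  have hsub : 0 < α - H := sub_pos.2 hHα
  have h1 := rpow_two_mul_div_add_sq_le hA (rpow_nonneg ht α)
    (p := 1 / (2 * α)) (by positivity) (by rw [div_lt_one (by positivity)]; linarith)
  have h2 := rpow_two_mul_div_add_sq_le hA (rpow_nonneg ht α)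
    (p := H / α) (by positivity) (by rwa [div_lt_one hα0])
  rw [← rpow_mul ht, show 2 * (1 / (2 * α)) = 1 / α by field_simp,
    show α * (1 / α) = 1 by field_simp, rpow_one,
    show 1 - 1 / (2 * α) = (2 * α - 1) / (2 * α) by field_simp] at h1
  rw [← rpow_mul ht, show 2 * (H / α) = 2 * H / α by ring,
    show α * (2 * H / α) = 2 * H by field_simp,
    show 1 - H / α = (α - H) / α by field_simp] at h2
  have hcoef : (1 / (2 * α)) ^ (1 / α) * ((2 * α - 1) / (2 * α)) ^ (2 - 1 / α) =
      (2 * α - 1) ^ (2 - 1 / α) / (2 * α) ^ 2 := by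
    have hsplit : (2 * α) ^ (1 / α) * (2 * α) ^ (2 - 1 / α) = (2 * α) ^ 2 := by
      rw [← rpow_add (by positivity), add_sub_cancel, rpow_two]
    rw [div_rpow zero_le_one (by positivity), div_rpow hα1.le (by positivity), one_rpow,
      div_mul_div_comm, one_mul, hsplit]
  rw [hcoef] at h1
  have hle : (H / α) ^ (2 * H / α) ≤ 1 :=
    rpow_le_one (by positivity) ((div_le_one hα0).2 hHα.le) (by positivity)
  calc _ = 2 * ρ₁ ^ 2 * (t / (A + t ^ α) ^ 2) +
        2 * ρ₂ ^ 2 * (t ^ (2 * H) / (A + t ^ α) ^ 2) := by ring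
    _ ≤ 2 * ρ₁ ^ 2 * ((2 * α - 1) ^ (2 - 1 / α) / (2 * α) ^ 2 * A ^ (1 / α - 2)) +
        2 * ρ₂ ^ 2 * (1 * ((α - H) / α) ^ (2 - 2 * H / α) * A ^ (2 * H / α - 2)) := by
      gcongr
      exact h2.trans (by gcongr)
    _ = ρ₁ ^ 2 * (2 * α - 1) ^ (2 - 1 / α) / α ^ 2 * A ^ (1 / α - 2) / 2 +
        2 * ρ₂ ^ 2 * A ^ (2 * H / α - 2) * ((α - H) / α) ^ (2 - 2 * H / α) := by
      ring
    _ ≤ _ := by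
      gcongr
      exact half_le_self (by positivity)
end
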